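/- Let D > 0 and let C be a finite nonempty set of trajectories. Suppose s ∈ C satisfies x_s(0) ≤ x_u(0) for all u ∈ C, and diam({s,u}) ≤ D for all u ∈ C. Then diam(C) ≤ (4 + √2)·D/2. -/

import Mathlib

noncomputable section

/-- Position at time `t` of the trajectory `(a, v)`, i.e. `a + v*t`. -/
def trajPos (s : ℝ × ℝ) (t : ℝ) : ℝ := s.1 + s.2 * t

/-- Diameter of a finite set of trajectories: the integral over `[0,1]` of the
width of the set of positions; `0` for the empty set. -/
noncomputable def kdiam (C : Finset (ℝ × ℝ)) : ℝ :=
  if h : C.Nonempty then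
    ∫ t in (0:ℝ)..1,
      (C.sup' h (fun s => trajPos s t) - C.inf' h (fun s => trajPos s t))
  else 0

/-- A `k`-clustering of `S`: pairwise disjoint (possibly empty) clusters
indexed by `Fin k` whose union is `S`. -/
def IsClustering (S : Finset (ℝ × ℝ)) (k : ℕ) (𝒞 : Fin k → Finset (ℝ × ℝ)) : Prop :=
  (∀ i j : Fin k, i ≠ j → Disjoint (𝒞 i) (𝒞 j)) ∧
  Finset.univ.biUnion 𝒞 = S

/-- Sum of the diameters of the clusters. -/
noncomputable def sd {k : ℕ} (𝒞 : Fin k → Finset (ℝ × ℝ)) : ℝ :=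
  ∑ i, kdiam (𝒞 i)

/-- Maximum diameter of a cluster. -/
noncomputable def md {k : ℕ} (𝒞 : Fin k → Finset (ℝ × ℝ)) : ℝ :=
  ⨆ i, kdiam (𝒞 i)

/-- An SD-optimal `k`-clustering: minimizes `sd` among all `k`-clusterings of `S`. -/
def SDOptimal (S : Finset (ℝ × ℝ)) (k : ℕ) (𝒞 : Fin k → Finset (ℝ × ℝ)) : Prop :=
  IsClustering S k 𝒞 ∧
  ∀ 𝒟 : Fin k → Finset (ℝ × ℝ), IsClustering S k 𝒟 → sd 𝒞 ≤ sd 𝒟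

/-- Optimal value of the maximum diameter over all `k`-clusterings of `S`. -/
noncomputable def optmd (S : Finset (ℝ × ℝ)) (k : ℕ) : ℝ :=
  sInf {x | ∃ 𝒞 : Fin k → Finset (ℝ × ℝ), IsClustering S k 𝒞 ∧ x = md 𝒞}

/-- The strip `{(x,t) : 0 ≤ t ≤ 1}`. -/
def strip : Set (ℝ × ℝ) := {p | 0 ≤ p.2 ∧ p.2 ≤ 1}

/-- The graph of a trajectory inside the strip. -/
def trajGraph (s : ℝ × ℝ) : Set (ℝ × ℝ) :=
  {p | 0 ≤ p.2 ∧ p.2 ≤ 1 ∧ p.1 = trajPos s p.2}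

/-- The strip minus the union of the graphs of the trajectories of `S`. -/
def freeRegion (S : Finset (ℝ × ℝ)) : Set (ℝ × ℝ) :=
  strip \ ⋃ s ∈ S, trajGraph s

/-- A hole of `S`: a connected component of the strip minus the graphs. -/
def IsHole (S : Finset (ℝ × ℝ)) (h : Set (ℝ × ℝ)) : Prop :=
  ∃ p ∈ freeRegion S, h = connectedComponentIn (freeRegion S) p

/-- `s` is to the left of the hole `h`. -/
def LeftOf (s : ℝ × ℝ) (h : Set (ℝ × ℝ)) : Prop :=
  ∃ p ∈ h, trajPos s p.2 < p.1

open Classical in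
/-- The trajectories of `S` to the left of `h`. -/
noncomputable def Sleft (S : Finset (ℝ × ℝ)) (h : Set (ℝ × ℝ)) : Finset (ℝ × ℝ) :=
  S.filter (fun s => LeftOf s h)

open Classical in
/-- The trajectories of `S` to the right of `h`. -/
noncomputable def Sright (S : Finset (ℝ × ℝ)) (h : Set (ℝ × ℝ)) : Finset (ℝ × ℝ) :=
  S.filter (fun s => ¬ LeftOf s h)

/-- The hole `h` separates the clusters `A` and `B`. -/
def Separates (S : Finset (ℝ × ℝ)) (h : Set (ℝ × ℝ))
    (A B : Finset (ℝ × ℝ)) : Prop :=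
  (A ⊆ Sleft S h ∧ B ⊆ Sright S h) ∨ (B ⊆ Sleft S h ∧ A ⊆ Sright S h)

/-- The span of a cluster: the region of the strip between its left and right sides. -/
noncomputable def cspan (C : Finset (ℝ × ℝ)) : Set (ℝ × ℝ) :=
  if h : C.Nonempty then
    {p | 0 ≤ p.2 ∧ p.2 ≤ 1 ∧
      C.inf' h (fun s => trajPos s p.2) ≤ p.1 ∧
      p.1 ≤ C.sup' h (fun s => trajPos s p.2)}
  else ∅

/-- A hole is covered by a clustering if it is contained in the span of some cluster. -/
def Covered {k : ℕ} (𝒞 : Fin k → Finset (ℝ × ℝ)) (h : Set (ℝ × ℝ)) : Prop :=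
  ∃ i, h ⊆ cspan (𝒞 i)

/-- A well-separated clustering: every two distinct nonempty clusters are
separated by some uncovered hole. -/
def WellSeparated (S : Finset (ℝ × ℝ)) (k : ℕ)
    (𝒞 : Fin k → Finset (ℝ × ℝ)) : Prop :=
  IsClustering S k 𝒞 ∧
  ∀ i j : Fin k, i ≠ j → (𝒞 i).Nonempty → (𝒞 j).Nonempty →
    ∃ h, IsHole S h ∧ ¬ Covered 𝒞 h ∧ Separates S h (𝒞 i) (𝒞 j)

end

theorem continuous_trajPos (s : ℝ × ℝ) : Continuous (trajPos s) := by
  unfold trajPos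
  fun_prop

theorem continuous_width (C : Finset (ℝ × ℝ)) (hC : C.Nonempty) :
    Continuous fun t => C.sup' hC (fun s => trajPos s t) - C.inf' hC (fun s => trajPos s t) :=
  (Continuous.finset_sup'_apply hC fun s _ => continuous_trajPos s).sub
    (Continuous.finset_inf'_apply hC fun s _ => continuous_trajPos s)

theorem kdiam_pair (s u : ℝ × ℝ) :
    kdiam {s, u} = ∫ t in (0:ℝ)..1, |trajPos u t - trajPos s t| := by
  rw [kdiam, dif_pos (Finset.insert_nonempty s {u})]
  refine intervalIntegral.integral_congr fun t _ => ?_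
  simp only [Finset.sup'_insert (Finset.singleton_nonempty u),
    Finset.inf'_insert (Finset.singleton_nonempty u), Finset.sup'_singleton, Finset.inf'_singleton]
  exact max_sub_min_eq_abs _ _

theorem integral_affine (a v p q : ℝ) :
    ∫ t in p..q, (a + v * t) = a * (q - p) + v * (q ^ 2 - p ^ 2) / 2 := by
  rw [intervalIntegral.integral_add
      (Continuous.intervalIntegrable (by fun_prop) _ _)
      (Continuous.intervalIntegrable (by fun_prop) _ _),
    intervalIntegral.integral_const_mul, integral_id, intervalIntegral.integral_const, smul_eq_mul]
  ring

/-- Testing an affine function against the sign function that changes sign at `r`. -/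
theorem abs_signed_integral_le (a v r : ℝ) (h0 : 0 ≤ r) (h1 : r ≤ 1) :
    |2 * a * r + v * r ^ 2 - a - v / 2| ≤ ∫ t in (0:ℝ)..1, |a + v * t| := by
  have hint (p q : ℝ) : IntervalIntegrable (fun t => |a + v * t|) MeasureTheory.volume p q :=
    Continuous.intervalIntegrable (by fun_prop) _ _
  rw [← intervalIntegral.integral_add_adjacent_intervals (hint 0 r) (hint r 1)]
  have hl := intervalIntegral.abs_integral_le_integral_abs (f := fun t => a + v * t)
    (μ := MeasureTheory.volume) h0
  have hr := intervalIntegral.abs_integral_le_integral_abs (f := fun t => a + v * t)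
    (μ := MeasureTheory.volume) h1
  rw [integral_affine, abs_le] at hl hr
  rw [abs_le]
  constructor <;> linarith [hl.1, hl.2, hr.1, hr.2]

theorem affine_endpoint_bounds {a v D : ℝ} (h : ∫ t in (0:ℝ)..1, |a + v * t| ≤ D) :
    |2 * a + v| ≤ 2 * D ∧ |a| ≤ (1 + √2) * D ∧ |a + v| ≤ (1 + √2) * D := by
  have h2 : √2 ^ 2 = 2 := Real.sq_sqrt (by norm_num)
  have hpos : 0 < √2 - 1 := sub_pos.2 (Real.lt_sqrt_of_sq_lt (by norm_num))
  have hlt : √2 < 2 := by nlinarith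
  have key (z : ℝ) (hz : |(√2 - 1) * z| ≤ D) : |z| ≤ (1 + √2) * D := by
    rw [abs_mul, abs_of_pos hpos] at hz
    calc |z| = (1 + √2) * ((√2 - 1) * |z|) := by linear_combination (-|z|) * h2
      _ ≤ _ := by gcongr
  refine ⟨?_, key _ ?_, key _ ?_⟩
  · have := (abs_signed_integral_le a v 1 zero_le_one le_rfl).trans h
    rw [abs_le] at this ⊢
    constructor <;> linarith [this.1, this.2]
  · refine le_of_eq_of_le (congrArg _ ?_)
      ((abs_signed_integral_le a v (√2 / 2) (by linarith) (by linarith)).trans h)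
    linear_combination (-v / 4) * h2
  · rw [← abs_neg]
    refine le_of_eq_of_le (congrArg _ ?_)
      ((abs_signed_integral_le a v (1 - √2 / 2) (by linarith) (by linarith)).trans h)
    linear_combination (-v / 4) * h2

theorem affine_mem_Icc_of_le_half {a v D t : ℝ} (ha : 0 ≤ a)
    (h : ∫ t in (0:ℝ)..1, |a + v * t| ≤ D) (h0 : 0 ≤ t) (h1 : t ≤ 1 / 2) :
    a + v * t ∈ Set.Icc (-(2 * t * D)) ((1 + √2 * (1 - 2 * t)) * D) := by
  obtain ⟨hm, ha', -⟩ := affine_endpoint_bounds h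
  rw [abs_le] at hm ha'
  constructor <;> nlinarith

theorem affine_mem_Icc_of_half_le {a v D t : ℝ} (ha : 0 ≤ a)
    (h : ∫ t in (0:ℝ)..1, |a + v * t| ≤ D) (h0 : 1 / 2 ≤ t) (h1 : t ≤ 1) :
    a + v * t ∈ Set.Icc (-((1 + √2 * (2 * t - 1)) * D)) (2 * t * D) := by
  obtain ⟨hm, -, hb⟩ := affine_endpoint_bounds h
  rw [abs_le] at hm hb
  constructor <;> nlinarith

theorem sup'_sub_inf'_le {ι : Type*} {C : Finset ι} (hC : C.Nonempty) {f : ι → ℝ} {c l r : ℝ}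
    (h : ∀ u ∈ C, f u - c ∈ Set.Icc (-l) r) : C.sup' hC f - C.inf' hC f ≤ l + r := by
  have hsup : C.sup' hC f ≤ c + r := Finset.sup'_le hC f fun u hu => by linarith [(h u hu).2]
  have hinf : c - l ≤ C.inf' hC f := Finset.le_inf' hC f fun u hu => by linarith [(h u hu).1]
  linarith

/-- a greedy cluster, built from a leftmost trajectory `s` together
with all trajectories at pairwise diameter at most `D` from `s`, has diameter at
most `(4 + √2) D / 2`. -/
theorem stmt12 (D : ℝ) (hD : 0 < D) (C : Finset (ℝ × ℝ)) (hC : C.Nonempty)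
    (s : ℝ × ℝ) (hs : s ∈ C)
    (hleft : ∀ u ∈ C, trajPos s 0 ≤ trajPos u 0)
    (hdiam : ∀ u ∈ C, kdiam {s, u} ≤ D) :
    kdiam C ≤ (4 + Real.sqrt 2) * D / 2 := by
  have hpos (u : ℝ × ℝ) (t : ℝ) :
      trajPos u t - trajPos s t = (u.1 - s.1) + (u.2 - s.2) * t := by
    unfold trajPos
    ring
  have ha (u) (hu : u ∈ C) : 0 ≤ u.1 - s.1 := by
    simpa [trajPos] using hleft u hu
  have hint (u) (hu : u ∈ C) : ∫ t in (0:ℝ)..1, |(u.1 - s.1) + (u.2 - s.2) * t| ≤ D := by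
    simpa only [kdiam_pair, hpos] using hdiam u hu
  have hw (p q : ℝ) := (continuous_width C hC).intervalIntegrable (μ := MeasureTheory.volume) p q
  rw [kdiam, dif_pos hC,
    ← intervalIntegral.integral_add_adjacent_intervals (hw 0 (1 / 2)) (hw (1 / 2) 1)]
  have hl := intervalIntegral.integral_mono_on (by norm_num) (hw 0 (1 / 2))
    (g := fun t => (1 + √2) * D + (2 - 2 * √2) * D * t)
    (Continuous.intervalIntegrable (by fun_prop) _ _) fun t ht =>
      (sup'_sub_inf'_le hC (c := trajPos s t) fun u hu => by
        rw [hpos]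
        exact affine_mem_Icc_of_le_half (ha u hu) (hint u hu) ht.1 ht.2).trans_eq (by ring)
  have hr := intervalIntegral.integral_mono_on (by norm_num) (hw (1 / 2) 1)
    (g := fun t => (1 - √2) * D + (2 + 2 * √2) * D * t)
    (Continuous.intervalIntegrable (by fun_prop) _ _) fun t ht =>
      (sup'_sub_inf'_le hC (c := trajPos s t) fun u hu => by
        rw [hpos]
        exact affine_mem_Icc_of_half_le (ha u hu) (hint u hu) ht.1 ht.2).trans_eq (by ring)
  rw [integral_affine] at hl hr
  linarith
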